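/- Let Φ be a local Zhou weight related to |f₀|²e^{-2φ₀} near o, and for a germ of holomorphic function f at o set ν(f, Φ) := σ(log|f|, Φ). Then ν(·, Φ) : 𝒪_o∖{0} → ℝ_{≥0} satisfies: (1) ν(fg, Φ) = ν(f, Φ) + ν(g, Φ); (2) ν(f+g, Φ) ≥ min{ ν(f, Φ), ν(g, Φ) } (whenever f+g ≢ 0); (3) ν(f, Φ) = 0 whenever f(o) ≠ 0. In particular ν(·, Φ) is a valuation on the ring 𝒪_o of germs of holomorphic functions at o. -/

import Mathlib

open MeasureTheory Filter Topology
open scoped ENNReal NNReal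

noncomputable section

/-- `ℂⁿ`. -/
abbrev Cn (n : ℕ) : Type := Fin n → ℂ

variable {n : ℕ}

/-- The exponential function `EReal → ℝ≥0∞`, with `exp ⊥ = 0` and `exp ⊤ = ⊤`. -/
def expE (x : EReal) : ℝ≥0∞ :=
  if x = ⊥ then 0 else if x = ⊤ then ⊤ else ENNReal.ofReal (Real.exp x.toReal)

/-- The logarithm `ℝ → EReal`, with value `⊥` for `x ≤ 0`. -/
def elog (x : ℝ) : EReal := if x ≤ 0 then (⊥ : EReal) else ((Real.log x : ℝ) : EReal)

/-- The density `e^{c·φ} : ℂⁿ → [0,∞]` associated to an extended-real-valued `φ`. -/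
def wexp (c : ℝ) (φ : Cn n → EReal) (z : Cn n) : ℝ≥0∞ := expE ((c : EReal) * φ z)

/-- `|f₀|² = ∑ⱼ |f₀ⱼ|²` as a `[0,∞]`-valued density, for a tuple `f₀` of functions. -/
def normSq2 {m : ℕ} (f₀ : Fin m → Cn n → ℂ) (z : Cn n) : ℝ≥0∞ :=
  ∑ j, (‖f₀ j z‖₊ : ℝ≥0∞) ^ 2

/-- `log |f₀| = (1/2) log ∑ⱼ |f₀ⱼ|²` for a tuple `f₀`. -/
def logAbsT {m : ℕ} (f₀ : Fin m → Cn n → ℂ) (z : Cn n) : EReal :=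
  elog (Real.sqrt (∑ j, ‖f₀ j z‖ ^ 2))

/-- The weight `|f₀|² e^{-2φ₀}`. -/
def dens0 {m : ℕ} (f₀ : Fin m → Cn n → ℂ) (φ₀ : Cn n → EReal) (z : Cn n) : ℝ≥0∞ :=
  normSq2 f₀ z * wexp (-2) φ₀ z

/-- A nonnegative function is (Lebesgue-)integrable near the origin. -/
def IntNear (g : Cn n → ℝ≥0∞) : Prop := ∃ U ∈ 𝓝 (0 : Cn n), (∫⁻ z in U, g z) < ⊤

/-- `ψ ≤ φ + O(1)` near the origin. -/
def leO (ψ φ : Cn n → EReal) : Prop := ∃ C : ℝ, ∀ᶠ z in 𝓝 (0 : Cn n), ψ z ≤ φ z + (C : EReal)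

/-- `ψ = φ + O(1)` near the origin. -/
def eqO (ψ φ : Cn n → EReal) : Prop := leO ψ φ ∧ leO φ ψ

/-- The truncated average of `u` over the circle `θ ↦ z + r e^{iθ} w`, truncated below at `-m`. -/
def circleAvg (u : Cn n → EReal) (z w : Cn n) (r : ℝ) (m : ℕ) : ℝ :=
  (2 * Real.pi)⁻¹ * ∫ θ in (0:ℝ)..(2 * Real.pi),
    (max (u (z + ((r : ℂ) * Complex.exp (Complex.I * (θ : ℂ))) • w)) ((-(m : ℝ) : ℝ) : EReal)).toReal

/-- `u` is plurisubharmonic on `Ω`: it is upper semicontinuous on `Ω`, takes values in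
`[-∞, ∞)`, is not identically `-∞` on any connected component of `Ω`, and satisfies the
sub-mean value inequality on all small circles inside complex lines. -/
structure PSHOn (u : Cn n → EReal) (Ω : Set (Cn n)) : Prop where
  usc : UpperSemicontinuousOn u Ω
  lt_top : ∀ z ∈ Ω, u z < ⊤
  not_botOnComponents : ∀ z ∈ Ω, ∃ w ∈ connectedComponentIn Ω z, u w ≠ ⊥
  submean : ∀ z ∈ Ω, ∀ w : Cn n, ∃ ε > 0, ∀ r : ℝ, 0 < r → r < ε →
    u z ≤ ⨅ m : ℕ, ((circleAvg u z w r m : ℝ) : EReal)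

/-- `u` is plurisubharmonic near the origin. -/
def PSHNear (u : Cn n → EReal) : Prop := ∃ U ∈ 𝓝 (0 : Cn n), IsOpen U ∧ PSHOn u U

/-- `f` is holomorphic near the origin. -/
def HoloNear (f : Cn n → ℂ) : Prop := ∃ U ∈ 𝓝 (0 : Cn n), IsOpen U ∧ DifferentiableOn ℂ f U

/-- `Φ` is a (local) Zhou weight near the origin related to a general nonnegative
weight `W`. -/
structure IsZhouWeightFor (W : Cn n → ℝ≥0∞) (Φ : Cn n → EReal) : Prop where
  psh : PSHNear Φ
  intN : ∃ N₁ : ℕ, ∀ N₀ : ℕ, N₁ ≤ N₀ →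
    IntNear fun z => W z * ENNReal.ofReal (‖z‖ ^ (2 * N₀)) * wexp (-2) Φ z
  nonint : ¬ IntNear fun z => W z * wexp (-2) Φ z
  maximal : ∀ φ' : Cn n → EReal, PSHNear φ' → leO Φ φ' →
    (¬ IntNear fun z => W z * wexp (-2) φ' z) → eqO φ' Φ

/-- `Φ` is a local Zhou weight related to `|f₀|² e^{-2φ₀}` near the origin (including the
standing assumptions that `f₀` is a tuple of holomorphic functions near `o`, `φ₀` is
plurisubharmonic near `o`, and `|f₀|² e^{-2φ₀}` is integrable near `o`). -/
structure IsLocalZhouWeight {m : ℕ} (f₀ : Fin m → Cn n → ℂ) (φ₀ : Cn n → EReal)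
    (Φ : Cn n → EReal) : Prop where
  holo : ∀ j, HoloNear (f₀ j)
  psh₀ : PSHNear φ₀
  int₀ : IntNear (dens0 f₀ φ₀)
  zhou : IsZhouWeightFor (dens0 f₀ φ₀) Φ

/-- The Zhou number (relative type) `σ(ψ, Φ) = sup { b ≥ 0 : ψ ≤ bΦ + O(1) near o }`. -/
def zhouNumber (ψ Φ : Cn n → EReal) : ℝ :=
  sSup {b : ℝ | 0 ≤ b ∧ leO ψ fun z => (b : EReal) * Φ z}

/-- `log ‖f‖ : ℂⁿ → EReal`. -/
def logAbs (f : Cn n → ℂ) (z : Cn n) : EReal := elog ‖f z‖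

/-- `ν(f, Φ) = σ(log|f|, Φ)`. -/
def nuNumber (f : Cn n → ℂ) (Φ : Cn n → EReal) : ℝ := zhouNumber (logAbs f) Φ

/-- The jumping number `c_o^G(Φ) = sup { c ≥ 0 : |G|² e^{-2cΦ} integrable near o }`. -/
def jumping (G : Cn n → ℂ) (Φ : Cn n → EReal) : ℝ :=
  sSup {c : ℝ | 0 ≤ c ∧ IntNear fun z => (‖G z‖₊ : ℝ≥0∞) ^ 2 * wexp (-2 * c) Φ z}

/-- The inclusion `ℐ(φ)ₒ ⊆ ℐ(ψ)ₒ` of multiplier ideals at the origin. -/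
def mIdealLE (φ ψ : Cn n → EReal) : Prop :=
  ∀ f : Cn n → ℂ, HoloNear f →
    (IntNear fun z => (‖f z‖₊ : ℝ≥0∞) ^ 2 * wexp (-2) φ z) →
    IntNear fun z => (‖f z‖₊ : ℝ≥0∞) ^ 2 * wexp (-2) ψ z

/-- The Tian function `Tn(t; f, v, φ₀) = sup { c ≥ 0 : |f|^{2t} e^{-2cv - 2φ₀} integrable near o }`. -/
def tian (t : ℝ) (f : Cn n → ℂ) (v φ₀ : Cn n → EReal) : ℝ :=
  sSup {c : ℝ | 0 ≤ c ∧
    IntNear fun z => ENNReal.ofReal (‖f z‖ ^ (2 * t)) * wexp (-2 * c) v z * wexp (-2) φ₀ z}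

theorem expE_coe (x : ℝ) : expE (x : EReal) = ENNReal.ofReal (Real.exp x) := by
  simp [expE]

theorem neg_two_mul_bot : ((-2 : ℝ) : EReal) * ⊥ = ⊤ :=
  EReal.coe_mul_bot_of_neg (by norm_num)

theorem neg_two_mul_top : ((-2 : ℝ) : EReal) * ⊤ = ⊥ :=
  EReal.coe_mul_top_of_neg (by norm_num)

theorem expE_neg_two_mul_le {x y : EReal} {C : ℝ} (h : x ≤ y + C) :
    expE (((-2 : ℝ) : EReal) * y) ≤
      ENNReal.ofReal (Real.exp (2 * C)) * expE (((-2 : ℝ) : EReal) * x) := by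
  induction y with
  | bot =>
    have hx : x = ⊥ := by simpa using h
    subst hx
    rw [neg_two_mul_bot, show expE ⊤ = ⊤ by simp [expE], ENNReal.mul_top]
    simp [Real.exp_pos]
  | top => rw [neg_two_mul_top]; simp [expE]
  | coe y =>
    induction x with
    | bot =>
      rw [neg_two_mul_bot, show expE ⊤ = ⊤ by simp [expE], ENNReal.mul_top]
      · exact le_top
      · simp [Real.exp_pos]
    | top =>
      rw [← EReal.coe_add, top_le_iff] at h
      exact absurd h (EReal.coe_ne_top _)
    | coe x =>
      rw [← EReal.coe_add, EReal.coe_le_coe_iff] at h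
      rw [← EReal.coe_mul, ← EReal.coe_mul, expE_coe, expE_coe,
        ← ENNReal.ofReal_mul (Real.exp_pos _).le, ← Real.exp_add]
      exact ENNReal.ofReal_le_ofReal (Real.exp_le_exp.2 (by linarith))

theorem wexp_neg_two_le {φ ψ : Cn n → EReal} {z : Cn n} {C : ℝ} (h : ψ z ≤ φ z + C) :
    wexp (-2) φ z ≤ ENNReal.ofReal (Real.exp (2 * C)) * wexp (-2) ψ z :=
  expE_neg_two_mul_le h

theorem wexp_neg_two_anti {φ ψ : Cn n → EReal} {z : Cn n} (h : ψ z ≤ φ z) :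
    wexp (-2) φ z ≤ wexp (-2) ψ z := by
  simpa using wexp_neg_two_le (φ := φ) (ψ := ψ) (z := z) (C := 0) (by simpa using h)

theorem iSup_expE_truncate (x : EReal) :
    ⨆ M : ℕ, expE (((-2 : ℝ) : EReal) * max x ((-(M : ℝ) : ℝ) : EReal)) =
      expE (((-2 : ℝ) : EReal) * x) := by
  apply le_antisymm
  · refine iSup_le fun M => ?_
    simpa using expE_neg_two_mul_le (C := 0) (x := x) (y := max x ((-(M : ℝ) : ℝ) : EReal))
      (by simp)
  · induction x with
    | bot =>
      rw [neg_two_mul_bot]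
      refine le_of_eq_of_le (b := ⊤) (by simp [expE]) (le_of_eq ?_)
      rw [eq_comm, iSup_eq_top]
      intro b hb
      obtain ⟨M, hM⟩ := exists_nat_gt b.toReal
      refine ⟨M, ?_⟩
      rw [max_eq_right bot_le, ← EReal.coe_mul, expE_coe,
        ENNReal.lt_ofReal_iff_toReal_lt hb.ne]
      have := Real.add_one_le_exp (-2 * -(M : ℝ))
      have : (0 : ℝ) ≤ M := M.cast_nonneg
      linarith
    | top => rw [neg_two_mul_top]; simp [expE]
    | coe x =>
      obtain ⟨M, hM⟩ := exists_nat_ge (-x)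
      refine le_iSup_of_le M ?_
      rw [max_eq_left (EReal.coe_le_coe_iff.2 (by linarith))]

theorem measurable_expE : Measurable expE := by
  unfold expE
  exact Measurable.ite (measurableSet_singleton _) measurable_const
    (Measurable.ite (measurableSet_singleton _) measurable_const
      (ENNReal.measurable_ofReal.comp (Real.measurable_exp.comp measurable_ereal_toReal)))

/-- The function `a log |f| - D`, with value `⊥` on the zero set of `f`. -/
def logTerm (f : Cn n → ℂ) (a D : ℝ) (z : Cn n) : EReal :=
  if f z = 0 then ⊥ else ((a * Real.log ‖f z‖ - D : ℝ) : EReal)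

theorem logTerm_of_eq_zero {f : Cn n → ℂ} {a D : ℝ} {z : Cn n} (h : f z = 0) :
    logTerm f a D z = ⊥ := if_pos h

theorem logTerm_of_ne_zero {f : Cn n → ℂ} {a D : ℝ} {z : Cn n} (h : f z ≠ 0) :
    logTerm f a D z = ((a * Real.log ‖f z‖ - D : ℝ) : EReal) := if_neg h

theorem logAbs_of_eq_zero {f : Cn n → ℂ} {z : Cn n} (h : f z = 0) : logAbs f z = ⊥ := by
  simp [logAbs, elog, h]

theorem logAbs_of_ne_zero {f : Cn n → ℂ} {z : Cn n} (h : f z ≠ 0) :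
    logAbs f z = ((Real.log ‖f z‖ : ℝ) : EReal) := by
  simp [logAbs, elog, h]

theorem logAbs_le_mul_add_iff {f : Cn n → ℂ} {z : Cn n} {b C : ℝ} (hb : 0 < b) (x : EReal) :
    logAbs f z ≤ (b : EReal) * x + C ↔ logTerm f b⁻¹ (C / b) z ≤ x := by
  by_cases hf : f z = 0
  · simp [logTerm_of_eq_zero hf, logAbs_of_eq_zero hf]
  rw [logTerm_of_ne_zero hf, logAbs_of_ne_zero hf]
  induction x with
  | bot =>
    rw [EReal.coe_mul_bot_of_pos hb, EReal.bot_add]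
    simp only [le_bot_iff, EReal.coe_ne_bot]
  | top => simp [EReal.coe_mul_top_of_pos hb]
  | coe x =>
    rw [← EReal.coe_mul, ← EReal.coe_add, EReal.coe_le_coe_iff, EReal.coe_le_coe_iff]
    have : b⁻¹ * Real.log ‖f z‖ - C / b = (Real.log ‖f z‖ - C) / b := by ring
    rw [this, div_le_iff₀ hb]
    constructor <;> intro h <;> linarith

theorem logTerm_add {f : Cn n → ℂ} {a D C : ℝ} {z : Cn n} :
    logTerm f a (D + C) z = logTerm f a D z - (C : EReal) := by
  by_cases hf : f z = 0
  · simp [logTerm_of_eq_zero hf]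
  · rw [logTerm_of_ne_zero hf, logTerm_of_ne_zero hf, ← EReal.coe_sub]
    ring_nf

theorem logTerm_add_le_iff {f : Cn n → ℂ} {a D C : ℝ} {z : Cn n} {x : EReal} :
    logTerm f a (D + C) z ≤ x ↔ logTerm f a D z ≤ x + C := by
  rw [logTerm_add, EReal.sub_le_iff_le_add] <;> simp

theorem logTerm_anti {f : Cn n → ℂ} {a a' D D' : ℝ} {z : Cn n} (hz : ‖f z‖ ≤ 1)
    (ha : a ≤ a') (hD : D ≤ D') : logTerm f a' D' z ≤ logTerm f a D z := by
  by_cases hf : f z = 0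
  · simp [logTerm_of_eq_zero hf]
  · rw [logTerm_of_ne_zero hf, logTerm_of_ne_zero hf, EReal.coe_le_coe_iff]
    have := Real.log_nonpos (norm_nonneg _) hz
    nlinarith

theorem logTerm_le_neg {f : Cn n → ℂ} {a D : ℝ} {z : Cn n} (hz : ‖f z‖ ≤ 1) (ha : 0 ≤ a) :
    logTerm f a D z ≤ ((-D : ℝ) : EReal) := by
  by_cases hf : f z = 0
  · simp [logTerm_of_eq_zero hf]
  · rw [logTerm_of_ne_zero hf, EReal.coe_le_coe_iff]
    have := Real.log_nonpos (norm_nonneg _) hz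
    nlinarith

theorem continuousAt_logTerm {f : Cn n → ℂ} {a D : ℝ} {z : Cn n} (hf : ContinuousAt f z)
    (hz : f z ≠ 0) : ContinuousAt (logTerm f a D) z := by
  have h1 : ContinuousAt (fun z => ((a * Real.log ‖f z‖ - D : ℝ) : EReal)) z :=
    continuous_coe_real_ereal.continuousAt.comp
      ((continuousAt_const.mul (hf.norm.log (norm_ne_zero_iff.2 hz))).sub continuousAt_const)
  refine h1.congr ?_
  filter_upwards [hf.eventually_ne hz] with w hw
  rw [logTerm_of_ne_zero hw]

theorem upperSemicontinuousAt_logTerm {f : Cn n → ℂ} {a D : ℝ} {z : Cn n} (ha : 0 < a)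
    (hf : ContinuousAt f z) : UpperSemicontinuousAt (logTerm f a D) z := by
  by_cases hz : f z = 0
  · intro y hy
    rw [logTerm_of_eq_zero hz] at hy
    obtain ⟨c, -, hc⟩ := EReal.lt_iff_exists_real_btwn.1 hy
    have hpos : ∀ᶠ w in 𝓝 z, ‖f w‖ < Real.exp ((c + D) / a) := by
      refine hf.norm.eventually_lt_const ?_
      simpa [hz] using Real.exp_pos _
    filter_upwards [hpos] with w hw
    refine lt_of_le_of_lt ?_ hc
    by_cases hw0 : f w = 0
    · simp [logTerm_of_eq_zero hw0]
    · rw [logTerm_of_ne_zero hw0, EReal.coe_le_coe_iff]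
      have h1 : Real.log ‖f w‖ < (c + D) / a :=
        (Real.log_lt_iff_lt_exp (norm_pos_iff.2 hw0)).2 hw
      rw [lt_div_iff₀ ha] at h1
      linarith
  · exact (continuousAt_logTerm hf hz).upperSemicontinuousAt

/-- The parametrized circle `θ ↦ z + r e^{iθ} v`. -/
def circlePath (z v : Cn n) (r : ℝ) (θ : ℝ) : Cn n :=
  z + ((r : ℂ) * Complex.exp (Complex.I * (θ : ℂ))) • v

theorem continuous_circlePath (z v : Cn n) (r : ℝ) : Continuous (circlePath z v r) := by
  unfold circlePath
  fun_prop

theorem circleAvg_eq (u : Cn n → EReal) (z v : Cn n) (r : ℝ) (m : ℕ) :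
    circleAvg u z v r m = (2 * Real.pi)⁻¹ * ∫ θ in (0 : ℝ)..(2 * Real.pi),
      (max (u (circlePath z v r θ)) ((-(m : ℝ) : ℝ) : EReal)).toReal := rfl

theorem intervalIntegrable_truncate {h : ℝ → EReal} (hu : UpperSemicontinuous h)
    (ht : ∀ θ, h θ < ⊤) (m c d : ℝ) :
    IntervalIntegrable (fun θ => (max (h θ) (m : EReal)).toReal) volume c d := by
  have hmeas : Measurable fun θ => (max (h θ) (m : EReal)).toReal :=
    measurable_ereal_toReal.comp (hu.measurable.max measurable_const)
  obtain ⟨θ₀, -, hmax⟩ := (hu.upperSemicontinuousOn (Set.uIcc c d)).exists_isMaxOn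
    Set.nonempty_uIcc isCompact_uIcc
  have hlt : max (h θ₀) (m : EReal) < ⊤ := max_lt (ht _) (EReal.coe_lt_top m)
  refine (intervalIntegrable_const (c := max |m| |(max (h θ₀) (m : EReal)).toReal|)).mono_fun
    hmeas.aestronglyMeasurable ?_
  rw [EventuallyLE, ae_restrict_iff' measurableSet_uIoc]
  refine Eventually.of_forall fun θ hθ => ?_
  have h1 : h θ ≤ h θ₀ := hmax (Set.uIoc_subset_uIcc hθ)
  have hb : ∀ x : EReal, max x (m : EReal) ≠ ⊥ := fun x =>
    ((EReal.bot_lt_coe m).trans_le (le_max_right _ _)).ne'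
  have h2 : (max (h θ) (m : EReal)).toReal ≤ (max (h θ₀) (m : EReal)).toReal :=
    EReal.toReal_le_toReal (max_le_max_right _ h1) (hb _) hlt.ne
  have h3 : m ≤ (max (h θ) (m : EReal)).toReal := by
    have := EReal.toReal_le_toReal (le_max_right (h θ) (m : EReal)) (EReal.coe_ne_bot m)
      (max_lt (ht _) (EReal.coe_lt_top m)).ne
    simpa using this
  rw [Real.norm_eq_abs, Real.norm_eq_abs, abs_of_nonneg (le_max_of_le_left (abs_nonneg m))]
  refine abs_le.2 ⟨?_, ?_⟩
  · have := neg_abs_le m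
    have := le_max_left |m| |(max (h θ₀) (m : EReal)).toReal|
    linarith
  · exact h2.trans ((le_abs_self _).trans (le_max_right _ _))

theorem upperSemicontinuous_comp_circlePath {u : Cn n → EReal} {s : Set (Cn n)} {z v : Cn n}
    {r : ℝ} (hs : IsOpen s) (hu : UpperSemicontinuousOn u s)
    (hmem : ∀ θ, circlePath z v r θ ∈ s) :
    UpperSemicontinuous fun θ => u (circlePath z v r θ) := by
  intro θ y hy
  have h1 := hu _ (hmem θ) y hy
  rw [hs.nhdsWithin_eq (hmem θ)] at h1
  exact (continuous_circlePath z v r).continuousAt.eventually h1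

theorem circleAvg_mono {u u' : Cn n → EReal} {s : Set (Cn n)} {z v : Cn n} {r : ℝ} {m : ℕ}
    (hs : IsOpen s) (hu : UpperSemicontinuousOn u s) (hu' : UpperSemicontinuousOn u' s)
    (ht : ∀ z ∈ s, u z < ⊤) (ht' : ∀ z ∈ s, u' z < ⊤)
    (hmem : ∀ θ, circlePath z v r θ ∈ s) (hle : ∀ z ∈ s, u z ≤ u' z) :
    circleAvg u z v r m ≤ circleAvg u' z v r m := by
  rw [circleAvg_eq, circleAvg_eq]
  refine mul_le_mul_of_nonneg_left ?_ (by positivity)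
  refine intervalIntegral.integral_mono (by positivity)
    (intervalIntegrable_truncate (upperSemicontinuous_comp_circlePath hs hu hmem)
      (fun θ => ht _ (hmem θ)) _ _ _)
    (intervalIntegrable_truncate (upperSemicontinuous_comp_circlePath hs hu' hmem)
      (fun θ => ht' _ (hmem θ)) _ _ _) fun θ => ?_
  exact EReal.toReal_le_toReal (max_le_max_right _ (hle _ (hmem θ)))
    ((EReal.bot_lt_coe _).trans_le (le_max_right _ _)).ne'
    (max_lt (ht' _ (hmem θ)) (EReal.coe_lt_top _)).ne

/-- The mean value property of `a log |f| - D` on a disc where `f` has no zeros. -/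
theorem logTerm_le_circleAvg {f : Cn n → ℂ} {u : Cn n → EReal} {s : Set (Cn n)} {z v : Cn n}
    {r a D : ℝ} {m : ℕ} (hs : IsOpen s) (hu : UpperSemicontinuousOn u s)
    (ht : ∀ z ∈ s, u z < ⊤) (hf : DifferentiableOn ℂ f s) (hf0 : ∀ z ∈ s, f z ≠ 0) (hr : 0 < r)
    (hmem : ∀ t : ℂ, ‖t‖ ≤ r → z + t • v ∈ s) (hle : ∀ z ∈ s, logTerm f a D z ≤ u z) :
    logTerm f a D z ≤ ((circleAvg u z v r m : ℝ) : EReal) := by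
  have hpath : ∀ θ, circlePath z v r θ ∈ s := fun θ => hmem _ (by
    rw [norm_mul, mul_comm Complex.I, Complex.norm_exp_ofReal_mul_I]
    simp [abs_of_pos hr])
  have hz : z ∈ s := by simpa using hmem 0 (by simpa using hr.le)
  have hline : Continuous fun t : ℂ => z + t • v := by fun_prop
  have hopen : IsOpen ((fun t : ℂ => z + t • v) ⁻¹' s) := hs.preimage hline
  have hdiff : DifferentiableOn ℂ (fun t : ℂ => f (z + t • v)) ((fun t : ℂ => z + t • v) ⁻¹' s) :=
    hf.comp (by fun_prop) fun t ht => ht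
  have hsub : Metric.closedBall (0 : ℂ) |r| ⊆ (fun t : ℂ => z + t • v) ⁻¹' s := fun t ht =>
    hmem t (by simpa [abs_of_pos hr] using ht)
  have havg := AnalyticOnNhd.circleAverage_log_norm_of_ne_zero
    ((hdiff.analyticOnNhd hopen).mono hsub) fun t ht => hf0 _ (hsub ht)
  have hcirc : ∀ θ : ℝ, z + circleMap 0 r θ • v = circlePath z v r θ := fun θ => by
    simp [circleMap, circlePath, mul_comm]
  simp only [Real.circleAverage, hcirc, smul_eq_mul, zero_smul, add_zero] at havg
  have hcont : Continuous fun θ => Real.log ‖f (circlePath z v r θ)‖ := by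
    refine Continuous.log ?_ fun θ => norm_ne_zero_iff.2 (hf0 _ (hpath θ))
    exact (hf.continuousOn.comp_continuous (continuous_circlePath z v r) hpath).norm
  have hint : a * Real.log ‖f z‖ - D = (2 * Real.pi)⁻¹ * ∫ θ in (0 : ℝ)..(2 * Real.pi),
      (a * Real.log ‖f (circlePath z v r θ)‖ - D) := by
    rw [intervalIntegral.integral_sub ((hcont.const_mul a).intervalIntegrable _ _)
      intervalIntegrable_const, intervalIntegral.integral_const_mul,
      intervalIntegral.integral_const, ← havg, smul_eq_mul]
    have := Real.pi_ne_zero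
    field_simp
    ring
  rw [logTerm_of_ne_zero (hf0 z hz), EReal.coe_le_coe_iff, hint, circleAvg_eq]
  refine mul_le_mul_of_nonneg_left ?_ (by positivity)
  refine intervalIntegral.integral_mono (by positivity)
    (((hcont.const_mul a).sub continuous_const).intervalIntegrable _ _)
    (intervalIntegrable_truncate (upperSemicontinuous_comp_circlePath hs hu hpath)
      (fun θ => ht _ (hpath θ)) _ _ _) fun θ => ?_
  have h1 := (hle _ (hpath θ)).trans (le_max_left _ ((-(m : ℝ) : ℝ) : EReal))
  rw [logTerm_of_ne_zero (hf0 _ (hpath θ))] at h1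
  have h2 := EReal.toReal_le_toReal h1 (EReal.coe_ne_bot _)
    (max_lt (ht _ (hpath θ)) (EReal.coe_lt_top _)).ne
  simpa only [EReal.toReal_coe] using h2

theorem exists_pos_disc_subset {s : Set (Cn n)} {z : Cn n} (hs : s ∈ 𝓝 z) (v : Cn n) :
    ∃ ε > 0, ∀ t : ℂ, ‖t‖ < ε → z + t • v ∈ s := by
  have hline : ContinuousAt (fun t : ℂ => z + t • v) 0 := by fun_prop
  have := hline.preimage_mem_nhds (by simpa using hs)
  obtain ⟨ε, hε, h⟩ := Metric.mem_nhds_iff.1 this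
  exact ⟨ε, hε, fun t ht => h (by simpa using ht)⟩

/-- The maximum of a psh function and a supremum of functions `aᵢ log |f| - Dᵢ` is psh, as soon as
the supremum is upper semicontinuous and finite. -/
theorem pshNear_max_iSup_logTerm {Φ : Cn n → EReal} (hΦ : PSHNear Φ) {f : Cn n → ℂ}
    (hf : HoloNear f) (hf0 : ¬ ∀ᶠ z in 𝓝 (0 : Cn n), f z = 0) {ι : Type*} [Nonempty ι]
    (a D : ι → ℝ) (husc : ∀ᶠ z in 𝓝 (0 : Cn n),
      UpperSemicontinuousAt (fun z => ⨆ i, logTerm f (a i) (D i) z) z)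
    (hlt : ∀ᶠ z in 𝓝 (0 : Cn n), ⨆ i, logTerm f (a i) (D i) z < ⊤) :
    PSHNear fun z => max (Φ z) (⨆ i, logTerm f (a i) (D i) z) := by
  obtain ⟨U, hU, hUo, hΦU⟩ := hΦ
  obtain ⟨V, hV, hVo, hfV⟩ := hf
  obtain ⟨R, hR, hball⟩ := Metric.mem_nhds_iff.1
    (inter_mem (inter_mem hU hV) (inter_mem husc hlt))
  have hballU : Metric.ball (0 : Cn n) R ⊆ U := fun z hz => (hball hz).1.1
  have hballV : Metric.ball (0 : Cn n) R ⊆ V := fun z hz => (hball hz).1.2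
  have hΦusc := hΦU.usc.mono hballU
  have husc' : UpperSemicontinuousOn (fun z => max (Φ z) (⨆ i, logTerm f (a i) (D i) z))
      (Metric.ball 0 R) :=
    hΦusc.sup fun z hz => UpperSemicontinuousAt.upperSemicontinuousWithinAt _
      (show UpperSemicontinuousAt _ z from (hball hz).2.1)
  have htop : ∀ z ∈ Metric.ball (0 : Cn n) R,
      max (Φ z) (⨆ i, logTerm f (a i) (D i) z) < ⊤ := fun z hz =>
    max_lt (hΦU.lt_top z (hballU hz)) (hball hz).2.2
  have hfR := hfV.mono hballV
  refine ⟨Metric.ball 0 R, Metric.ball_mem_nhds _ hR, Metric.isOpen_ball, husc', htop, ?_, ?_⟩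
  · intro z hz
    have hconn : connectedComponentIn (Metric.ball (0 : Cn n) R) z = Metric.ball 0 R :=
      (convex_ball (0 : Cn n) R).isPreconnected.connectedComponentIn hz
    rw [hconn]
    have : ∃ w ∈ Metric.ball (0 : Cn n) R, f w ≠ 0 := by
      by_contra! h
      exact hf0 (Filter.mem_of_superset (Metric.ball_mem_nhds _ hR) h)
    obtain ⟨w, hw, hfw⟩ := this
    refine ⟨w, hw, ne_of_gt ?_⟩
    obtain ⟨i⟩ := ‹Nonempty ι›
    refine lt_of_lt_of_le ?_ ((le_iSup (fun i => logTerm f (a i) (D i) w) i).trans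
      (le_max_right _ _))
    rw [logTerm_of_ne_zero hfw]
    exact EReal.bot_lt_coe _
  · intro z hz v
    obtain ⟨ε₁, hε₁, hsub⟩ := hΦU.submean z (hballU hz) v
    obtain ⟨ε₂, hε₂, hdisc⟩ := exists_pos_disc_subset (Metric.isOpen_ball.mem_nhds hz) v
    have hfirst : ∀ r : ℝ, 0 < r → r < min ε₁ ε₂ → ∀ m : ℕ, Φ z ≤
        ((circleAvg (fun z => max (Φ z) (⨆ i, logTerm f (a i) (D i) z)) z v r m : ℝ) : EReal) := by
      intro r hr hrε m
      refine ((hsub r hr (hrε.trans_le (min_le_left _ _))).trans (iInf_le _ m)).trans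
        (EReal.coe_le_coe_iff.2 ?_)
      refine circleAvg_mono Metric.isOpen_ball hΦusc husc' (fun z hz => hΦU.lt_top z (hballU hz))
        htop (fun θ => hdisc _ ?_) fun z _ => le_max_left _ _
      rw [norm_mul, mul_comm Complex.I, Complex.norm_exp_ofReal_mul_I]
      simpa [abs_of_pos hr] using hrε.trans_le (min_le_right _ _)
    by_cases hfz : f z = 0
    · refine ⟨min ε₁ ε₂, lt_min hε₁ hε₂, fun r hr hrε => le_iInf fun m => max_le
        (hfirst r hr hrε m) (iSup_le fun i => ?_)⟩
      rw [logTerm_of_eq_zero hfz]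
      exact bot_le
    · have hso : IsOpen (Metric.ball (0 : Cn n) R ∩ f ⁻¹' {0}ᶜ) :=
        hfR.continuousOn.isOpen_inter_preimage Metric.isOpen_ball isOpen_compl_singleton
      obtain ⟨ε₃, hε₃, hdisc'⟩ := exists_pos_disc_subset (hso.mem_nhds ⟨hz, hfz⟩) v
      refine ⟨min (min ε₁ ε₂) ε₃, lt_min (lt_min hε₁ hε₂) hε₃, fun r hr hrε => le_iInf fun m =>
        max_le (hfirst r hr (hrε.trans_le (min_le_left _ _)) m) (iSup_le fun i => ?_)⟩
      refine logTerm_le_circleAvg hso (husc'.mono Set.inter_subset_left)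
        (fun z hz => htop z hz.1) (hfR.mono Set.inter_subset_left) (fun z hz => hz.2) hr
        (fun t ht => hdisc' t (ht.trans_lt (hrε.trans_le (min_le_right _ _)))) fun z _ => ?_
      exact (le_iSup (fun i => logTerm f (a i) (D i) z) i).trans (le_max_right _ _)

theorem IntNear.const_mul {g : Cn n → ℝ≥0∞} (hg : IntNear g) {c : ℝ≥0∞} (hc : c ≠ ⊤) :
    IntNear fun z => c * g z := by
  obtain ⟨U, hU, hlt⟩ := hg
  refine ⟨U, hU, ?_⟩
  rw [lintegral_const_mul' _ _ hc]
  exact ENNReal.mul_lt_top hc.lt_top hlt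

theorem IntNear.mono {g h : Cn n → ℝ≥0∞} (hg : IntNear g)
    (hle : ∀ᶠ z in 𝓝 (0 : Cn n), h z ≤ g z) : IntNear h := by
  obtain ⟨U, hU, hlt⟩ := hg
  obtain ⟨r, hr, hsub⟩ := Metric.mem_nhds_iff.1 (inter_mem hU hle)
  refine ⟨Metric.ball 0 r, Metric.ball_mem_nhds _ hr, lt_of_le_of_lt ?_ hlt⟩
  exact (setLIntegral_mono' measurableSet_ball fun z hz => (hsub hz).2).trans
    (lintegral_mono_set fun z hz => (hsub hz).1)

theorem intNear_mul_wexp_of_le {W : Cn n → ℝ≥0∞} (hW : IntNear W) {Φ : Cn n → EReal} {T : ℝ}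
    (hT : ∀ᶠ z in 𝓝 (0 : Cn n), ((-T : ℝ) : EReal) ≤ Φ z) :
    IntNear fun z => W z * wexp (-2) Φ z := by
  refine (hW.const_mul (c := ENNReal.ofReal (Real.exp (2 * T))) ENNReal.ofReal_ne_top).mono ?_
  filter_upwards [hT] with z hz
  have h1 : wexp (-2) Φ z ≤ ENNReal.ofReal (Real.exp (2 * T)) := by
    refine (wexp_neg_two_anti (ψ := fun _ => ((-T : ℝ) : EReal)) hz).trans (le_of_eq ?_)
    rw [wexp, ← EReal.coe_mul, expE_coe]
    ring_nf
  rw [mul_comm]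
  gcongr

theorem aemeasurable_of_upperSemicontinuousOn {u : Cn n → EReal} {s : Set (Cn n)} (hs : IsOpen s)
    (hu : UpperSemicontinuousOn u s) : AEMeasurable u (volume.restrict s) :=
  aemeasurable_restrict_of_measurable_subtype hs.measurableSet
    (upperSemicontinuousOn_iff_restrict.2 hu).measurable

theorem aemeasurable_wexp {u : Cn n → EReal} {μ : Measure (Cn n)} (c : ℝ)
    (hu : AEMeasurable u μ) : AEMeasurable (wexp c u) μ :=
  measurable_expE.comp_aemeasurable (aemeasurable_const.mul hu)

theorem exists_aemeasurable_dens0 {m : ℕ} {f₀ : Fin m → Cn n → ℂ} {φ₀ : Cn n → EReal}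
    (hf : ∀ j, HoloNear (f₀ j)) (hφ : PSHNear φ₀) :
    ∃ R > 0, AEMeasurable (dens0 f₀ φ₀) (volume.restrict (Metric.ball 0 R)) := by
  obtain ⟨U, hU, hUo, hφU⟩ := hφ
  choose V hV hVo hfV using hf
  obtain ⟨R, hR, hsub⟩ := Metric.mem_nhds_iff.1 (inter_mem hU (iInter_mem.2 hV))
  refine ⟨R, hR, AEMeasurable.mul ?_ ?_⟩
  · refine Finset.aemeasurable_fun_sum _ fun j _ => ?_
    have hc : ContinuousOn (f₀ j) (Metric.ball 0 R) := (hfV j).continuousOn.mono fun z hz =>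
      Set.mem_iInter.1 (hsub hz).2 j
    exact ((hc.aemeasurable measurableSet_ball).nnnorm.coe_nnreal_ennreal).pow_const 2
  · exact aemeasurable_wexp _ (aemeasurable_of_upperSemicontinuousOn Metric.isOpen_ball
      (hφU.usc.mono fun z hz => (hsub hz).1))

/-- Truncations of a non-integrable weight have arbitrarily large integrals. -/
theorem exists_truncation_le_lintegral {W : Cn n → ℝ≥0∞} {Φ : Cn n → EReal} {r : ℝ} (hr : 0 < r)
    (hW : AEMeasurable W (volume.restrict (Metric.ball 0 r)))
    (hΦ : AEMeasurable Φ (volume.restrict (Metric.ball 0 r)))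
    (hnon : ¬ IntNear fun z => W z * wexp (-2) Φ z) {A : ℝ≥0∞} (hA : A < ⊤) :
    ∃ M : ℕ, A ≤ ∫⁻ z in Metric.ball 0 r,
      W z * wexp (-2) (fun z => max (Φ z) ((-(M : ℝ) : ℝ) : EReal)) z := by
  have htop : ∫⁻ z in Metric.ball 0 r, W z * wexp (-2) Φ z = ⊤ := by
    by_contra h
    exact hnon ⟨_, Metric.ball_mem_nhds _ hr, lt_top_iff_ne_top.2 h⟩
  have hmct := lintegral_iSup' (μ := volume.restrict (Metric.ball (0 : Cn n) r))
    (f := fun (M : ℕ) z => W z * wexp (-2) (fun z => max (Φ z) ((-(M : ℝ) : ℝ) : EReal)) z)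
    (fun M => hW.mul (aemeasurable_wexp _ (hΦ.max aemeasurable_const)))
    (Eventually.of_forall fun z M M' hM => mul_le_mul_right (wexp_neg_two_anti
      (max_le_max_left _ (EReal.coe_le_coe_iff.2 (neg_le_neg (Nat.cast_le.2 hM))))) _)
  have hpt : ∀ z, ⨆ M : ℕ, W z * wexp (-2) (fun z => max (Φ z) ((-(M : ℝ) : ℝ) : EReal)) z =
      W z * wexp (-2) Φ z := fun z => by
    rw [← ENNReal.mul_iSup]
    exact congrArg _ (iSup_expE_truncate (Φ z))
  simp only [hpt, htop] at hmct
  obtain ⟨M, hM⟩ := lt_iSup_iff.1 (hmct ▸ hA)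
  exact ⟨M, hM.le⟩

/-- A holomorphic function which vanishes on a nonempty open subset of a ball vanishes on the
ball. -/
theorem eq_zero_on_ball_of_eventually {f : Cn n → ℂ} {R : ℝ} {p : Cn n}
    (hf : DifferentiableOn ℂ f (Metric.ball 0 R)) (hp : p ∈ Metric.ball (0 : Cn n) R)
    (hfp : ∀ᶠ z in 𝓝 p, f z = 0) : ∀ q ∈ Metric.ball (0 : Cn n) R, f q = 0 := by
  intro q hq
  set L : ℂ → Cn n := fun t => p + t • (q - p) with hL
  have hLc : Continuous L := by fun_prop
  have hLd : Differentiable ℂ L := by fun_prop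
  have hopen : IsOpen (L ⁻¹' Metric.ball 0 R) := Metric.isOpen_ball.preimage hLc
  have hconv : Convex ℝ (L ⁻¹' Metric.ball 0 R) := by
    intro s hs t ht a b ha hb hab
    have : L (a • s + b • t) = a • L s + b • L t := by
      have h1 : (a : ℂ) + b = 1 := by exact_mod_cast hab
      ext i
      simp only [hL, Pi.add_apply, Pi.smul_apply, Pi.sub_apply, smul_eq_mul, Complex.real_smul]
      linear_combination (-(p i)) * h1
    rw [Set.mem_preimage, this]
    exact convex_ball (0 : Cn n) R hs ht ha hb hab
  have hana : AnalyticOnNhd ℂ (fun t => f (L t)) (L ⁻¹' Metric.ball 0 R) :=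
    (hf.comp hLd.differentiableOn fun t ht => ht).analyticOnNhd hopen
  have h0 : (fun t => f (L t)) =ᶠ[𝓝 0] 0 :=
    Tendsto.eventually (p := fun z => f z = 0) hLc.continuousAt (by simpa [hL] using hfp)
  have := hana.eqOn_zero_of_preconnected_of_eventuallyEq_zero hconv.isPreconnected
    (by simpa [hL] using hp) h0 (x := 1) (by simpa [hL] using hq)
  simpa [hL] using this

theorem exists_lt_and_ne_zero {W : Cn n → ℝ≥0∞} {Φ : Cn n → EReal} (hΦ : PSHNear Φ)
    (hW : IntNear W) (hnon : ¬ IntNear fun z => W z * wexp (-2) Φ z) {f : Cn n → ℂ}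
    (hf : HoloNear f) (hf0 : ¬ ∀ᶠ z in 𝓝 (0 : Cn n), f z = 0) {r : ℝ} (hr : 0 < r) (T : ℝ) :
    ∃ z ∈ Metric.ball (0 : Cn n) r, Φ z < ((-T : ℝ) : EReal) ∧ f z ≠ 0 := by
  obtain ⟨U, hU, hUo, hΦU⟩ := hΦ
  obtain ⟨V, hV, hVo, hfV⟩ := hf
  obtain ⟨R, hR, hsub⟩ := Metric.mem_nhds_iff.1
    (inter_mem (inter_mem hU hV) (Metric.ball_mem_nhds (0 : Cn n) hr))
  by_contra! h
  have hex : ∃ p ∈ Metric.ball (0 : Cn n) R, Φ p < ((-T : ℝ) : EReal) := by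
    by_contra! hge
    exact hnon (intNear_mul_wexp_of_le hW
      (Filter.mem_of_superset (Metric.ball_mem_nhds _ hR) hge))
  obtain ⟨p, hp, hpT⟩ := hex
  have hev : ∀ᶠ z in 𝓝 p, Φ z < ((-T : ℝ) : EReal) := by
    have := hΦU.usc p (hsub hp).1.1 _ hpT
    rwa [hUo.nhdsWithin_eq (hsub hp).1.1] at this
  refine hf0 (Filter.mem_of_superset (Metric.ball_mem_nhds _ hR) ?_)
  refine eq_zero_on_ball_of_eventually (hfV.mono fun z hz => (hsub hz).1.2) hp ?_
  filter_upwards [hev, Metric.isOpen_ball.mem_nhds hp] with z hz hzR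
  exact h z (hsub hzR).2 hz

theorem upperSemicontinuousAt_iSup_logTerm {f : Cn n → ℂ} {z : Cn n} {a D : ℕ → ℝ}
    (hf : ContinuousAt f z) (hf1 : ∀ᶠ y in 𝓝 z, ‖f y‖ ≤ 1) (ha : ∀ k, 0 < a k)
    (hD : ∀ k : ℕ, (k : ℝ) ≤ D k) :
    UpperSemicontinuousAt (fun z => ⨆ k, logTerm f (a k) (D k) z) z := by
  intro y hy
  obtain ⟨c, hc, hcy⟩ := EReal.lt_iff_exists_real_btwn.1 hy
  obtain ⟨K, hK⟩ := exists_nat_ge (-c)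
  have hfin : ∀ᶠ x in 𝓝 z, ∀ k ∈ Finset.range K, logTerm f (a k) (D k) x < c := by
    rw [Filter.eventually_all_finset]
    exact fun k _ => upperSemicontinuousAt_logTerm (ha k) hf _
      ((le_iSup (fun k => logTerm f (a k) (D k) z) k).trans_lt hc)
  filter_upwards [hfin, hf1] with x hx hx1
  refine lt_of_le_of_lt (iSup_le fun k => ?_) hcy
  by_cases hk : k < K
  · exact (hx k (Finset.mem_range.2 hk)).le
  · refine (logTerm_le_neg hx1 (ha k).le).trans (EReal.coe_le_coe_iff.2 ?_)
    have : (K : ℝ) ≤ k := Nat.cast_le.2 (not_lt.1 hk)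
    linarith [hD k]

/-- Lower bounds of a Zhou weight by functions `a k * log |f| - D k - k` on shrinking balls
improve, by maximality, to lower bounds by `a k * log |f| - D k - C` on a fixed ball, provided
that `D` grows fast enough. -/
theorem IsZhouWeightFor.exists_uniform_logTerm_le {W : Cn n → ℝ≥0∞} {Φ : Cn n → EReal}
    (hZ : IsZhouWeightFor W Φ) {f : Cn n → ℂ} (hf : HoloNear f)
    (hf0 : ¬ ∀ᶠ z in 𝓝 (0 : Cn n), f z = 0) {R : ℝ} (hR : 0 < R)
    (hfR : ∀ z ∈ Metric.ball (0 : Cn n) R, ‖f z‖ ≤ 1) {a D r : ℕ → ℝ} {M : ℕ → ℕ}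
    (ha : ∀ k, 0 < a k) (hrR : ∀ k, r k ≤ R)
    (hr : Antitone r) (hr0 : Tendsto r atTop (𝓝 0))
    (hM : ∀ i : ℕ, ENNReal.ofReal (Real.exp (2 * i)) * i ≤ ∫⁻ z in Metric.ball 0 (r i),
      W z * wexp (-2) (fun z => max (Φ z) ((-(M i : ℝ) : ℝ) : EReal)) z)
    (hMD : ∀ i k, i < k → (M i : ℝ) ≤ D k) (hD : ∀ k : ℕ, (k : ℝ) ≤ D k)
    (hle : ∀ k : ℕ, ∀ z ∈ Metric.ball (0 : Cn n) (r k), logTerm f (a k) (D k + k) z ≤ Φ z) :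
    ∃ C : ℝ, ∃ ρ > 0, ∀ k, ∀ z ∈ Metric.ball (0 : Cn n) ρ, logTerm f (a k) (D k + C) z ≤ Φ z := by
  set φ : Cn n → EReal := fun z => max (Φ z) (⨆ k, logTerm f (a k) (D k) z) with hφ
  have hpsh : PSHNear φ := by
    refine pshNear_max_iSup_logTerm hZ.psh hf hf0 a D ?_ ?_
    · obtain ⟨V, hV, hVo, hfV⟩ := hf
      filter_upwards [hV, Metric.ball_mem_nhds (0 : Cn n) hR] with z hzV hzR
      exact upperSemicontinuousAt_iSup_logTerm
        ((hfV.differentiableAt (hVo.mem_nhds hzV)).continuousAt)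
        (Filter.mem_of_superset (Metric.isOpen_ball.mem_nhds hzR) hfR) ha hD
    · filter_upwards [Metric.ball_mem_nhds (0 : Cn n) hR] with z hz
      refine lt_of_le_of_lt (iSup_le fun k => (logTerm_le_neg (hfR z hz) (ha k).le).trans
        (EReal.coe_le_coe_iff.2 ?_)) (EReal.coe_lt_top 0)
      linarith [hD k, k.cast_nonneg (α := ℝ)]
  have hlarge : ∀ i : ℕ, (i : ℝ≥0∞) ≤ ∫⁻ z in Metric.ball 0 (r i), W z * wexp (-2) φ z := by
    intro i
    have hexp : ENNReal.ofReal (Real.exp (2 * i)) ≠ 0 := by simp [Real.exp_pos]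
    refine (ENNReal.mul_le_mul_iff_right hexp ENNReal.ofReal_ne_top).1 ((hM i).trans ?_)
    rw [← lintegral_const_mul' _ _ ENNReal.ofReal_ne_top]
    refine setLIntegral_mono' measurableSet_ball fun z hz => ?_
    rw [mul_left_comm]
    gcongr
    refine wexp_neg_two_le ?_
    have hi : (0 : EReal) ≤ ((i : ℝ) : EReal) := EReal.coe_nonneg.2 i.cast_nonneg
    have hself : ∀ x : EReal, x ≤ x + ((i : ℝ) : EReal) := fun x => le_add_of_nonneg_right hi
    refine max_le ((le_max_left _ _).trans (hself _)) (iSup_le fun k => ?_)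
    rcases le_or_gt k i with hk | hk
    · have h1 : logTerm f (a k) (D k) z ≤ Φ z + ((k : ℝ) : EReal) :=
        logTerm_add_le_iff.1 (hle k z (Metric.ball_subset_ball (hr hk) hz))
      exact h1.trans (add_le_add (le_max_left _ _)
        (EReal.coe_le_coe_iff.2 (Nat.cast_le.2 hk)))
    · refine (logTerm_le_neg (hfR z (Metric.ball_subset_ball (hrR i) hz)) (ha k).le).trans ?_
      exact ((EReal.coe_le_coe_iff.2 (neg_le_neg (hMD i k hk))).trans (le_max_right _ _)).trans
        (hself _)
  have hnon : ¬ IntNear fun z => W z * wexp (-2) φ z := by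
    rintro ⟨U, hU, hlt⟩
    obtain ⟨s, hs, hsU⟩ := Metric.mem_nhds_iff.1 hU
    obtain ⟨N, hN⟩ := ENNReal.exists_nat_gt hlt.ne
    obtain ⟨i, hiN, his⟩ := ((eventually_ge_atTop N).and (hr0.eventually_lt_const hs)).exists
    have h1 := (hlarge i).trans
      (lintegral_mono_set ((Metric.ball_subset_ball his.le).trans hsU))
    exact absurd (hN.trans_le ((Nat.cast_le.2 hiN).trans h1)) (lt_irrefl _)
  obtain ⟨⟨C, hC⟩, -⟩ := hZ.maximal φ hpsh
    ⟨0, Eventually.of_forall fun z => by simp [hφ]⟩ hnon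
  obtain ⟨ρ, hρ, hsub⟩ := Metric.mem_nhds_iff.1 hC
  refine ⟨C, ρ, hρ, fun k z hz => logTerm_add_le_iff.2 ?_⟩
  exact ((le_iSup (fun k => logTerm f (a k) (D k) z) k).trans (le_max_right _ _)).trans (hsub hz)

theorem exists_truncations_le_lintegral {W : Cn n → ℝ≥0∞} {Φ : Cn n → EReal} {R : ℝ}
    (hW : AEMeasurable W (volume.restrict (Metric.ball 0 R)))
    (hΦ : AEMeasurable Φ (volume.restrict (Metric.ball 0 R)))
    (hnon : ¬ IntNear fun z => W z * wexp (-2) Φ z) {r : ℕ → ℝ} (hr : ∀ k, 0 < r k)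
    (hrR : ∀ k, r k ≤ R) :
    ∃ M : ℕ → ℕ, ∀ i : ℕ, ENNReal.ofReal (Real.exp (2 * i)) * i ≤
      ∫⁻ z in Metric.ball 0 (r i),
        W z * wexp (-2) (fun z => max (Φ z) ((-(M i : ℝ) : ℝ) : EReal)) z := by
  have hres : ∀ i, volume.restrict (Metric.ball (0 : Cn n) (r i)) ≤
      volume.restrict (Metric.ball 0 R) := fun i =>
    Measure.restrict_mono (Metric.ball_subset_ball (hrR i)) le_rfl
  choose M hM using fun i : ℕ => exists_truncation_le_lintegral (hr i)
    (hW.mono_measure (hres i)) (hΦ.mono_measure (hres i)) hnon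
    (A := ENNReal.ofReal (Real.exp (2 * i)) * i)
    (ENNReal.mul_lt_top ENNReal.ofReal_lt_top (ENNReal.natCast_lt_top i))
  exact ⟨M, hM⟩

theorem le_sum_range_of_lt (M : ℕ → ℕ) {i k : ℕ} (h : i < k) :
    (M i : ℝ) ≤ ∑ j ∈ Finset.range k, (M j : ℝ) :=
  Finset.single_le_sum (f := fun j => (M j : ℝ)) (fun j _ => (M j).cast_nonneg)
    (Finset.mem_range.2 h)

/-- If a Zhou weight is bounded below by small multiples of `log |f|` near the origin, then these
bounds hold on a common ball. -/
theorem IsZhouWeightFor.exists_ball_logTerm_le {W : Cn n → ℝ≥0∞} {Φ : Cn n → EReal}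
    (hZ : IsZhouWeightFor W Φ) {f : Cn n → ℂ} (hf : HoloNear f)
    (hf0 : ¬ ∀ᶠ z in 𝓝 (0 : Cn n), f z = 0) {R : ℝ} (hR : 0 < R)
    (hfR : ∀ z ∈ Metric.ball (0 : Cn n) R, ‖f z‖ ≤ 1)
    (hW : AEMeasurable W (volume.restrict (Metric.ball 0 R)))
    (hΦ : AEMeasurable Φ (volume.restrict (Metric.ball 0 R))) {a : ℕ → ℝ} (ha : ∀ k, 0 < a k)
    (h : ∀ k, ∃ E : ℝ, ∀ᶠ z in 𝓝 (0 : Cn n), logTerm f (a k) E z ≤ Φ z) :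
    ∃ ρ > 0, ∀ k, ∃ E : ℝ, ∀ z ∈ Metric.ball (0 : Cn n) ρ, logTerm f (a k) E z ≤ Φ z := by
  choose E hE using h
  choose s hs hsE using fun k => Metric.mem_nhds_iff.1 (hE k)
  set t : ℕ → ℝ := fun j => min (s j) (min R (1 / (j + 1))) with ht
  have htpos : ∀ j, 0 < t j := fun j => lt_min (hs j) (lt_min hR Nat.one_div_pos_of_nat)
  set r : ℕ → ℝ := fun k => (Finset.range (k + 1)).inf' ⟨0, by simp⟩ t with hr
  have hrt : ∀ k, r k ≤ t k := fun k => Finset.inf'_le _ (by simp)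
  have hrpos : ∀ k, 0 < r k := fun k => (Finset.lt_inf'_iff _).2 fun j _ => htpos j
  have hrR : ∀ k, r k ≤ R := fun k =>
    (hrt k).trans ((min_le_right _ _).trans (min_le_left _ _))
  have hranti : Antitone r := fun i k hik =>
    Finset.inf'_mono _ (Finset.range_mono (by omega)) _
  have hr0 : Tendsto r atTop (𝓝 0) :=
    squeeze_zero (fun k => (hrpos k).le)
      (fun k => (hrt k).trans ((min_le_right _ _).trans (min_le_right _ _)))
      tendsto_one_div_add_atTop_nhds_zero_nat
  obtain ⟨M, hM⟩ := exists_truncations_le_lintegral hW hΦ hZ.nonint hrpos hrR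
  have hsum : ∀ k, (0 : ℝ) ≤ ∑ j ∈ Finset.range k, (M j : ℝ) := fun k =>
    Finset.sum_nonneg fun j _ => (M j).cast_nonneg
  obtain ⟨C, ρ, hρ, hC⟩ := hZ.exists_uniform_logTerm_le hf hf0 hR hfR (a := a)
    (D := fun k => max (E k) (∑ j ∈ Finset.range k, (M j : ℝ) + k)) ha hrR hranti hr0 hM
    (fun i k hik => (le_sum_range_of_lt M hik).trans
      ((le_add_of_nonneg_right k.cast_nonneg).trans (le_max_right _ _)))
    (fun k => (le_add_of_nonneg_left (hsum k)).trans (le_max_right _ _))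
    (fun k z hz =>
      (logTerm_anti (hfR z (Metric.ball_subset_ball (hrR k) hz)) le_rfl
        ((le_max_left _ _).trans (le_add_of_nonneg_right k.cast_nonneg))).trans
        (hsE k (Metric.ball_subset_ball ((hrt k).trans (min_le_left _ _)) hz)))
  exact ⟨ρ, hρ, fun k => ⟨_, hC k⟩⟩

/-- A constant that is optimal up to `1` in a lower bound `a * log |f| - E` of `Φ`. -/
theorem exists_almost_optimal_logTerm_le {f : Cn n → ℂ} {Φ : Cn n → EReal} {s : Set (Cn n)}
    {a T : ℝ} (hs : ∀ z ∈ s, ‖f z‖ ≤ 1) (h : ∃ E, ∀ z ∈ s, logTerm f a E z ≤ Φ z)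
    (hT : ¬ ∀ z ∈ s, logTerm f a T z ≤ Φ z) :
    ∃ E, T ≤ E ∧ (∀ z ∈ s, logTerm f a E z ≤ Φ z) ∧
      ¬ ∀ z ∈ s, logTerm f a (E - 1) z ≤ Φ z := by
  set S : Set ℝ := {E | ∀ z ∈ s, logTerm f a E z ≤ Φ z} with hS
  have hlow : ∀ E ∈ S, T ≤ E := by
    intro E hE
    by_contra! hlt
    exact hT fun z hz => (logTerm_anti (hs z hz) le_rfl hlt.le).trans (hE z hz)
  have hbdd : BddBelow S := ⟨T, hlow⟩
  obtain ⟨E, hE, hlt⟩ := exists_lt_of_csInf_lt h (lt_add_one (sInf S))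
  refine ⟨E, hlow E hE, hE, fun hcon => ?_⟩
  linarith [csInf_le hbdd hcon]

/-- A Zhou weight cannot be bounded below by arbitrarily small multiples of `log |f|`. -/
theorem IsZhouWeightFor.not_forall_exists_logTerm_le {W : Cn n → ℝ≥0∞} {Φ : Cn n → EReal}
    (hZ : IsZhouWeightFor W Φ) (hWint : IntNear W) {f : Cn n → ℂ} (hf : HoloNear f)
    (hf0 : ¬ ∀ᶠ z in 𝓝 (0 : Cn n), f z = 0) {R : ℝ} (hR : 0 < R)
    (hfR : ∀ z ∈ Metric.ball (0 : Cn n) R, ‖f z‖ ≤ 1)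
    (hW : AEMeasurable W (volume.restrict (Metric.ball 0 R)))
    (hΦ : AEMeasurable Φ (volume.restrict (Metric.ball 0 R))) :
    ¬ ∀ k : ℕ, ∃ E : ℝ, ∀ᶠ z in 𝓝 (0 : Cn n), logTerm f (1 / ((k : ℝ) + 1)) E z ≤ Φ z := by
  intro h
  obtain ⟨ρ, hρ, hE⟩ := hZ.exists_ball_logTerm_le hf hf0 hR hfR hW hΦ
    (a := fun k => 1 / ((k : ℝ) + 1)) (fun k => Nat.one_div_pos_of_nat) h
  set ρ' := min ρ R with hρ'
  have hρ'pos : 0 < ρ' := lt_min hρ hR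
  set r : ℕ → ℝ := fun k => ρ' * (1 / ((k : ℝ) + 1)) with hr
  have hrpos : ∀ k, 0 < r k := fun k => mul_pos hρ'pos Nat.one_div_pos_of_nat
  have hranti : Antitone r := fun i k hik =>
    mul_le_mul_of_nonneg_left (Nat.one_div_le_one_div hik) hρ'pos.le
  have hr0 : Tendsto r atTop (𝓝 0) := by
    simpa [hr] using tendsto_one_div_add_atTop_nhds_zero_nat.const_mul (b := ρ')
  have hrρ' : ∀ k, r k ≤ ρ' := fun k => (hranti (Nat.zero_le k)).trans (by simp [hr])
  have hrR : ∀ k, r k ≤ R := fun k => (hrρ' k).trans (min_le_right _ _)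
  have hfr : ∀ k, ∀ z ∈ Metric.ball (0 : Cn n) (r k), ‖f z‖ ≤ 1 := fun k z hz =>
    hfR z (Metric.ball_subset_ball (hrR k) hz)
  obtain ⟨M, hM⟩ := exists_truncations_le_lintegral hW hΦ hZ.nonint hrpos hrR
  set T : ℕ → ℝ := fun k => ∑ j ∈ Finset.range k, (M j : ℝ) + 2 * k with hT
  have hj : ∀ k, ∃ j : ℕ, ¬ ∀ z ∈ Metric.ball (0 : Cn n) (r k),
      logTerm f (1 / ((j : ℝ) + 1)) (T k) z ≤ Φ z := by
    intro k
    obtain ⟨z, hz, hzT, hfz⟩ := exists_lt_and_ne_zero hZ.psh hWint hZ.nonint hf hf0 (hrpos k)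
      (T k + 2)
    obtain ⟨j, hj⟩ := exists_nat_ge (-Real.log ‖f z‖)
    refine ⟨j, fun hcon => ?_⟩
    have hlt := (hcon z hz).trans_lt hzT
    rw [logTerm_of_ne_zero hfz, EReal.coe_lt_coe_iff] at hlt
    have hj1 : (0 : ℝ) < (j : ℝ) + 1 := by positivity
    have : -1 ≤ 1 / ((j : ℝ) + 1) * Real.log ‖f z‖ := by
      rw [one_div, inv_mul_eq_div, le_div_iff₀ hj1]
      linarith
    linarith
  choose j hj using hj
  choose E hTE hEle hEopt using fun k => exists_almost_optimal_logTerm_le (hfr k)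
    ((hE (j k)).imp fun E hE z hz => hE z
      (Metric.ball_subset_ball ((hrρ' k).trans (min_le_left _ _)) hz)) (hj k)
  have hsum : ∀ k, (0 : ℝ) ≤ ∑ j ∈ Finset.range k, (M j : ℝ) := fun k =>
    Finset.sum_nonneg fun j _ => (M j).cast_nonneg
  obtain ⟨C, s, hs, hC⟩ := hZ.exists_uniform_logTerm_le hf hf0 hR hfR
    (a := fun k => 1 / ((j k : ℝ) + 1)) (D := fun k => E k - k)
    (fun k => Nat.one_div_pos_of_nat) hrR hranti hr0 hM
    (fun i k hik => by
      have := le_sum_range_of_lt M hik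
      have := hTE k
      simp only [hT] at this
      linarith [k.cast_nonneg (α := ℝ)])
    (fun k => by
      have := hTE k
      simp only [hT] at this
      linarith [hsum k])
    (fun k z hz => by simpa using hEle k z hz)
  obtain ⟨N, hN⟩ := exists_nat_ge (C + 1)
  obtain ⟨k, hkN, hks⟩ := ((eventually_ge_atTop N).and (hr0.eventually_lt_const hs)).exists
  refine hEopt k fun z hz => (logTerm_anti (hfr k z hz) le_rfl ?_).trans
    (hC k z (Metric.ball_subset_ball hks.le hz))
  have : (N : ℝ) ≤ k := Nat.cast_le.2 hkN
  linarith

theorem PSHNear.exists_aemeasurable {u : Cn n → EReal} (hu : PSHNear u) :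
    ∃ R > 0, AEMeasurable u (volume.restrict (Metric.ball 0 R)) := by
  obtain ⟨U, hU, -, huU⟩ := hu
  obtain ⟨R, hR, hsub⟩ := Metric.mem_nhds_iff.1 hU
  exact ⟨R, hR, aemeasurable_of_upperSemicontinuousOn Metric.isOpen_ball (huU.usc.mono hsub)⟩

theorem IntNear.add {g h : Cn n → ℝ≥0∞} (hg : IntNear g) (hh : IntNear h) {R : ℝ} (hR : 0 < R)
    (hm : AEMeasurable g (volume.restrict (Metric.ball 0 R))) : IntNear fun z => g z + h z := by
  obtain ⟨U, hU, hUlt⟩ := hg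
  obtain ⟨V, hV, hVlt⟩ := hh
  obtain ⟨r, hr, hsub⟩ := Metric.mem_nhds_iff.1
    (inter_mem (inter_mem hU hV) (Metric.ball_mem_nhds (0 : Cn n) hR))
  refine ⟨Metric.ball 0 r, Metric.ball_mem_nhds _ hr, ?_⟩
  rw [lintegral_add_left' (hm.mono_measure
    (Measure.restrict_mono (fun z hz => (hsub hz).2) le_rfl))]
  exact ENNReal.add_lt_top.2
    ⟨(lintegral_mono_set fun z hz => (hsub hz).1.1).trans_lt hUlt,
      (lintegral_mono_set fun z hz => (hsub hz).1.2).trans_lt hVlt⟩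

theorem HoloNear.continuousAt {f : Cn n → ℂ} (hf : HoloNear f) : ContinuousAt f 0 := by
  obtain ⟨V, hV, hVo, hfV⟩ := hf
  exact (hfV.differentiableAt hV).continuousAt

theorem HoloNear.add {f g : Cn n → ℂ} (hf : HoloNear f) (hg : HoloNear g) :
    HoloNear fun z => f z + g z := by
  obtain ⟨U, hU, hUo, hfU⟩ := hf
  obtain ⟨V, hV, hVo, hgV⟩ := hg
  exact ⟨U ∩ V, inter_mem hU hV, hUo.inter hVo, (hfU.mono Set.inter_subset_left).add
    (hgV.mono Set.inter_subset_right)⟩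

theorem HoloNear.mul {f g : Cn n → ℂ} (hf : HoloNear f) (hg : HoloNear g) :
    HoloNear fun z => f z * g z := by
  obtain ⟨U, hU, hUo, hfU⟩ := hf
  obtain ⟨V, hV, hVo, hgV⟩ := hg
  exact ⟨U ∩ V, inter_mem hU hV, hUo.inter hVo, (hfU.mono Set.inter_subset_left).mul
    (hgV.mono Set.inter_subset_right)⟩

theorem HoloNear.exists_log_norm_le {f : Cn n → ℂ} (hf : HoloNear f) :
    ∃ B : ℝ, ∀ᶠ z in 𝓝 (0 : Cn n), f z ≠ 0 → Real.log ‖f z‖ ≤ B := by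
  refine ⟨Real.log (‖f 0‖ + 1), ?_⟩
  filter_upwards [hf.continuousAt.norm.eventually_le_const (lt_add_one ‖f 0‖)] with z hz hne
  exact Real.log_le_log (norm_pos_iff.2 hne) hz

/-- The set of `b ≥ 0` with `log |f| ≤ b Φ + O(1)` near the origin. -/
def zhouSet (f : Cn n → ℂ) (Φ : Cn n → EReal) : Set ℝ :=
  {b : ℝ | 0 ≤ b ∧ leO (logAbs f) fun z => (b : EReal) * Φ z}

theorem nuNumber_eq_sSup (f : Cn n → ℂ) (Φ : Cn n → EReal) : nuNumber f Φ = sSup (zhouSet f Φ) :=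
  rfl

theorem nuNumber_nonneg (f : Cn n → ℂ) (Φ : Cn n → EReal) : 0 ≤ nuNumber f Φ :=
  Real.sSup_nonneg fun _ hb => hb.1

theorem mem_zhouSet_iff {f : Cn n → ℂ} {Φ : Cn n → EReal} {b : ℝ} (hb : 0 < b) :
    b ∈ zhouSet f Φ ↔ ∃ E : ℝ, ∀ᶠ z in 𝓝 (0 : Cn n), logTerm f b⁻¹ E z ≤ Φ z := by
  constructor
  · rintro ⟨-, C, hC⟩
    exact ⟨C / b, hC.mono fun z hz => (logAbs_le_mul_add_iff hb _).1 hz⟩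
  · rintro ⟨E, hE⟩
    refine ⟨hb.le, E * b, hE.mono fun z hz => (logAbs_le_mul_add_iff hb _).2 ?_⟩
    rwa [mul_div_cancel_right₀ _ hb.ne']

theorem zero_mem_zhouSet {f : Cn n → ℂ} (hf : HoloNear f) (Φ : Cn n → EReal) :
    0 ∈ zhouSet f Φ := by
  obtain ⟨B, hB⟩ := hf.exists_log_norm_le
  refine ⟨le_rfl, B, hB.mono fun z hz => ?_⟩
  by_cases h : f z = 0
  · simp [logAbs_of_eq_zero h]
  · simp only [logAbs_of_ne_zero h, EReal.coe_zero, zero_mul, zero_add]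
    exact EReal.coe_le_coe_iff.2 (hz h)

theorem mem_zhouSet_of_le {f : Cn n → ℂ} (hf : HoloNear f) {Φ : Cn n → EReal} {b c : ℝ}
    (hc : c ∈ zhouSet f Φ) (hb : 0 ≤ b) (hbc : b ≤ c) : b ∈ zhouSet f Φ := by
  rcases hb.eq_or_lt with rfl | hb
  · exact zero_mem_zhouSet hf Φ
  obtain ⟨E, hE⟩ := (mem_zhouSet_iff (hb.trans_le hbc)).1 hc
  obtain ⟨B, hB⟩ := hf.exists_log_norm_le
  refine (mem_zhouSet_iff hb).2 ⟨E + (b⁻¹ - c⁻¹) * B, ?_⟩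
  filter_upwards [hE, hB] with z hz hzB
  refine le_trans ?_ hz
  by_cases h : f z = 0
  · simp [logTerm_of_eq_zero h]
  rw [logTerm_of_ne_zero h, logTerm_of_ne_zero h, EReal.coe_le_coe_iff]
  have h1 : c⁻¹ ≤ b⁻¹ := inv_anti₀ hb hbc
  nlinarith [hzB h]

theorem mem_zhouSet_of_lt_nuNumber {f : Cn n → ℂ} (hf : HoloNear f) {Φ : Cn n → EReal} {b : ℝ}
    (hb : 0 ≤ b) (hlt : b < nuNumber f Φ) : b ∈ zhouSet f Φ := by
  obtain ⟨c, hc, hbc⟩ := exists_lt_of_lt_csSup ⟨0, zero_mem_zhouSet hf Φ⟩ hlt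
  exact mem_zhouSet_of_le hf hc hb hbc.le

theorem IsZhouWeightFor.zhouSet_eq_of_ne_zero {W : Cn n → ℝ≥0∞} {Φ : Cn n → EReal}
    (hZ : IsZhouWeightFor W Φ) (hWint : IntNear W) {f : Cn n → ℂ} (hf : HoloNear f)
    (hf0 : f 0 ≠ 0) : zhouSet f Φ = {0} := by
  refine Set.eq_singleton_iff_unique_mem.2 ⟨zero_mem_zhouSet hf Φ, fun b hb => ?_⟩
  by_contra hne
  have hbpos : 0 < b := lt_of_le_of_ne hb.1 (Ne.symm hne)
  obtain ⟨E, hE⟩ := (mem_zhouSet_iff hbpos).1 hb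
  refine hZ.nonint (intNear_mul_wexp_of_le hWint (T := E - b⁻¹ * Real.log (‖f 0‖ / 2)) ?_)
  have hpos : 0 < ‖f 0‖ := norm_pos_iff.2 hf0
  filter_upwards [hE, hf.continuousAt.norm.eventually_const_lt (half_lt_self hpos)] with z hz hlt
  refine le_trans ?_ hz
  rw [logTerm_of_ne_zero (norm_pos_iff.1 ((half_pos hpos).trans hlt)), EReal.coe_le_coe_iff]
  have := mul_le_mul_of_nonneg_left (Real.log_le_log (half_pos hpos) hlt.le)
    (inv_nonneg.2 hbpos.le)
  linarith

theorem IsZhouWeightFor.bddAbove_zhouSet {W : Cn n → ℝ≥0∞} {Φ : Cn n → EReal}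
    (hZ : IsZhouWeightFor W Φ) (hWint : IntNear W) {R : ℝ} (hR : 0 < R)
    (hW : AEMeasurable W (volume.restrict (Metric.ball 0 R))) {f : Cn n → ℂ} (hf : HoloNear f)
    (hf0 : ¬ ∀ᶠ z in 𝓝 (0 : Cn n), f z = 0) : BddAbove (zhouSet f Φ) := by
  by_cases h0 : f 0 = 0
  · by_contra hunb
    obtain ⟨R', hR', hΦ⟩ := hZ.psh.exists_aemeasurable
    have hsmall : ∀ᶠ z in 𝓝 (0 : Cn n), ‖f z‖ ≤ 1 :=
      hf.continuousAt.norm.eventually_le_const (by simp [h0])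
    obtain ⟨s, hs, hsub⟩ := Metric.mem_nhds_iff.1 (inter_mem hsmall
      (inter_mem (Metric.ball_mem_nhds (0 : Cn n) hR) (Metric.ball_mem_nhds (0 : Cn n) hR')))
    refine hZ.not_forall_exists_logTerm_le hWint hf hf0 hs (fun z hz => (hsub hz).1)
      (hW.mono_measure (Measure.restrict_mono (fun z hz => (hsub hz).2.1) le_rfl))
      (hΦ.mono_measure (Measure.restrict_mono (fun z hz => (hsub hz).2.2) le_rfl)) fun k => ?_
    obtain ⟨b, hb, hkb⟩ := not_bddAbove_iff.1 hunb ((k : ℝ) + 1)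
    have hk : (0 : ℝ) < (k : ℝ) + 1 := by positivity
    rw [one_div]
    exact (mem_zhouSet_iff hk).1 (mem_zhouSet_of_le hf hb hk.le hkb.le)
  · rw [hZ.zhouSet_eq_of_ne_zero hWint hf h0]
    exact bddAbove_singleton

theorem PSHNear.max_logTerm {Φ : Cn n → EReal} (hΦ : PSHNear Φ) {f : Cn n → ℂ} (hf : HoloNear f)
    (hf0 : ¬ ∀ᶠ z in 𝓝 (0 : Cn n), f z = 0) {a : ℝ} (ha : 0 < a) (D : ℝ) :
    PSHNear fun z => max (Φ z) (logTerm f a D z) := by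
  have h := pshNear_max_iSup_logTerm hΦ hf hf0 (ι := Unit) (fun _ => a) (fun _ => D) ?_ ?_
  · simpa only [iSup_const] using h
  · simp only [iSup_const]
    obtain ⟨V, hV, hVo, hfV⟩ := hf
    filter_upwards [hV] with z hz
    exact upperSemicontinuousAt_logTerm ha
      (hfV.differentiableAt (hVo.mem_nhds hz)).continuousAt
  · refine Eventually.of_forall fun z => ?_
    rw [iSup_const]
    by_cases h : f z = 0
    · simp [logTerm_of_eq_zero h]
    · rw [logTerm_of_ne_zero h]
      exact EReal.coe_lt_top _

theorem IsZhouWeightFor.intNear_max_logTerm {W : Cn n → ℝ≥0∞} {Φ : Cn n → EReal}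
    (hZ : IsZhouWeightFor W Φ) {f : Cn n → ℂ} (hf : HoloNear f)
    (hf0 : ¬ ∀ᶠ z in 𝓝 (0 : Cn n), f z = 0) {b : ℝ} (hb : 0 < b) (hbS : b ∉ zhouSet f Φ) :
    IntNear fun z => W z * wexp (-2) (fun z => max (Φ z) (logTerm f b⁻¹ 0 z)) z := by
  by_contra hnon
  obtain ⟨⟨C, hC⟩, -⟩ := hZ.maximal _ (hZ.psh.max_logTerm hf hf0 (inv_pos.2 hb) 0)
    ⟨0, Eventually.of_forall fun z => by simp⟩ hnon
  refine hbS ((mem_zhouSet_iff hb).2 ⟨0 + C, hC.mono fun z hz => ?_⟩)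
  exact logTerm_add_le_iff.2 ((le_max_right _ _).trans hz)

/-- A lower bound by `log |f g|` dominates a lower bound by `log |f|` or by `log |g|`. -/
theorem logTerm_le_or_logTerm_le_of_mul {f g : Cn n → ℂ} {z : Cn n} {b₁ b₂ E : ℝ} {x : EReal}
    (hb₁ : 0 < b₁) (hb₂ : 0 < b₂) (h : logTerm (fun z => f z * g z) (b₁ + b₂)⁻¹ E z ≤ x) :
    logTerm f b₁⁻¹ E z ≤ x ∨ logTerm g b₂⁻¹ E z ≤ x := by
  by_cases hf : f z = 0
  · simp [logTerm_of_eq_zero hf]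
  by_cases hg : g z = 0
  · simp [logTerm_of_eq_zero hg]
  rw [logTerm_of_ne_zero (mul_ne_zero hf hg), norm_mul,
    Real.log_mul (norm_ne_zero_iff.2 hf) (norm_ne_zero_iff.2 hg)] at h
  rw [logTerm_of_ne_zero hf, logTerm_of_ne_zero hg]
  set p := Real.log ‖f z‖
  set q := Real.log ‖g z‖
  have hb : 0 < b₁ + b₂ := add_pos hb₁ hb₂
  rcases le_total (p * b₂) (q * b₁) with hpq | hpq
  · refine Or.inl (le_trans (EReal.coe_le_coe_iff.2 (sub_le_sub_right ?_ E)) h)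
    rw [inv_mul_eq_div, inv_mul_eq_div, div_le_div_iff₀ hb₁ hb]
    linarith
  · refine Or.inr (le_trans (EReal.coe_le_coe_iff.2 (sub_le_sub_right ?_ E)) h)
    rw [inv_mul_eq_div, inv_mul_eq_div, div_le_div_iff₀ hb₂ hb]
    linarith

theorem IsZhouWeightFor.add_notMem_zhouSet_mul {W : Cn n → ℝ≥0∞} {Φ : Cn n → EReal}
    (hZ : IsZhouWeightFor W Φ) {R : ℝ} (hR : 0 < R)
    (hW : AEMeasurable W (volume.restrict (Metric.ball 0 R))) {f g : Cn n → ℂ} (hf : HoloNear f)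
    (hg : HoloNear g) (hf0 : ¬ ∀ᶠ z in 𝓝 (0 : Cn n), f z = 0)
    (hg0 : ¬ ∀ᶠ z in 𝓝 (0 : Cn n), g z = 0) {b₁ b₂ : ℝ} (hb₁ : 0 < b₁) (hb₂ : 0 < b₂)
    (h₁ : b₁ ∉ zhouSet f Φ) (h₂ : b₂ ∉ zhouSet g Φ) :
    b₁ + b₂ ∉ zhouSet (fun z => f z * g z) Φ := by
  intro hmem
  obtain ⟨E, hE⟩ := (mem_zhouSet_iff (add_pos hb₁ hb₂)).1 hmem
  obtain ⟨R', hR', hm⟩ := (hZ.psh.max_logTerm hf hf0 (inv_pos.2 hb₁) 0).exists_aemeasurable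
  have hint := ((hZ.intNear_max_logTerm hf hf0 hb₁ h₁).add
    (hZ.intNear_max_logTerm hg hg0 hb₂ h₂) (lt_min hR hR')
    ((hW.mono_measure (Measure.restrict_mono (Metric.ball_subset_ball (min_le_left _ _))
      le_rfl)).mul (aemeasurable_wexp _ (hm.mono_measure (Measure.restrict_mono
        (Metric.ball_subset_ball (min_le_right _ _)) le_rfl))))).const_mul
    (c := ENNReal.ofReal (Real.exp (2 * max E 0))) ENNReal.ofReal_ne_top
  have hmax : ∀ (h : Cn n → ℂ) (a : ℝ) (z : Cn n), logTerm h a E z ≤ Φ z →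
      max (Φ z) (logTerm h a 0 z) ≤ Φ z + ((max E 0 : ℝ) : EReal) := by
    intro h a z hz
    refine max_le (le_add_of_nonneg_right (EReal.coe_nonneg.2 (le_max_right _ _))) ?_
    rw [← zero_add E, logTerm_add_le_iff] at hz
    exact hz.trans (add_le_add_right (EReal.coe_le_coe_iff.2 (le_max_left _ _)) _)
  refine hZ.nonint (hint.mono ?_)
  filter_upwards [hE] with z hz
  rw [← mul_add, mul_left_comm]
  gcongr
  rcases logTerm_le_or_logTerm_le_of_mul hb₁ hb₂ hz with h | h
  · exact (wexp_neg_two_le (ψ := fun z => max (Φ z) (logTerm f b₁⁻¹ 0 z))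
      (hmax f _ z h)).trans (mul_le_mul_right le_self_add _)
  · exact (wexp_neg_two_le (ψ := fun z => max (Φ z) (logTerm g b₂⁻¹ 0 z))
      (hmax g _ z h)).trans (mul_le_mul_right le_add_self _)

theorem logAbs_mul (f g : Cn n → ℂ) (z : Cn n) :
    logAbs (fun z => f z * g z) z = logAbs f z + logAbs g z := by
  by_cases hf : f z = 0
  · rw [logAbs_of_eq_zero hf, logAbs_of_eq_zero (by simp [hf]), EReal.bot_add]
  by_cases hg : g z = 0
  · rw [logAbs_of_eq_zero hg, logAbs_of_eq_zero (by simp [hg]), EReal.add_bot]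
  rw [logAbs_of_ne_zero hf, logAbs_of_ne_zero hg, logAbs_of_ne_zero (mul_ne_zero hf hg), norm_mul,
    Real.log_mul (norm_ne_zero_iff.2 hf) (norm_ne_zero_iff.2 hg), EReal.coe_add]

theorem add_mem_zhouSet_mul {f g : Cn n → ℂ} {Φ : Cn n → EReal} {b₁ b₂ : ℝ}
    (h₁ : b₁ ∈ zhouSet f Φ) (h₂ : b₂ ∈ zhouSet g Φ) :
    b₁ + b₂ ∈ zhouSet (fun z => f z * g z) Φ := by
  obtain ⟨hb₁, C₁, hC₁⟩ := h₁
  obtain ⟨hb₂, C₂, hC₂⟩ := h₂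
  refine ⟨add_nonneg hb₁ hb₂, C₁ + C₂, ?_⟩
  filter_upwards [hC₁, hC₂] with z hz₁ hz₂
  rw [logAbs_mul, EReal.coe_add, EReal.coe_add,
    EReal.right_distrib_of_nonneg (EReal.coe_nonneg.2 hb₁) (EReal.coe_nonneg.2 hb₂),
    add_add_add_comm]
  exact add_le_add hz₁ hz₂

theorem logAbs_add_le (f g : Cn n → ℂ) (z : Cn n) :
    logAbs (fun z => f z + g z) z ≤ max (logAbs f z) (logAbs g z) + ((Real.log 2 : ℝ) : EReal) := by
  have key : ∀ f g : Cn n → ℂ, ‖f z‖ ≤ ‖g z‖ →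
      logAbs (fun z => f z + g z) z ≤ logAbs g z + ((Real.log 2 : ℝ) : EReal) := by
    intro f g hfg
    by_cases hs : f z + g z = 0
    · rw [logAbs_of_eq_zero hs]
      exact bot_le
    have hg : g z ≠ 0 := by
      intro hg
      have hf : f z = 0 := by simpa [hg] using hfg
      exact hs (by simp [hf, hg])
    rw [logAbs_of_ne_zero hs, logAbs_of_ne_zero hg, ← EReal.coe_add, EReal.coe_le_coe_iff,
      ← Real.log_mul (norm_ne_zero_iff.2 hg) two_ne_zero]
    refine Real.log_le_log (norm_pos_iff.2 hs) ?_
    linarith [norm_add_le (f z) (g z)]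
  rcases le_total ‖f z‖ ‖g z‖ with h | h
  · exact (key f g h).trans (add_le_add_left (le_max_right _ _) _)
  · have := key g f h
    simp only [add_comm (g _)] at this
    exact this.trans (add_le_add_left (le_max_left _ _) _)

theorem mem_zhouSet_add {f g : Cn n → ℂ} {Φ : Cn n → EReal} {b : ℝ}
    (hf : b ∈ zhouSet f Φ) (hg : b ∈ zhouSet g Φ) : b ∈ zhouSet (fun z => f z + g z) Φ := by
  obtain ⟨hb, C₁, hC₁⟩ := hf
  obtain ⟨-, C₂, hC₂⟩ := hg
  refine ⟨hb, max C₁ C₂ + Real.log 2, ?_⟩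
  filter_upwards [hC₁, hC₂] with z hz₁ hz₂
  rw [EReal.coe_add, ← add_assoc]
  refine (logAbs_add_le f g z).trans (add_le_add_left (max_le ?_ ?_) _)
  · exact hz₁.trans (add_le_add_right (EReal.coe_le_coe_iff.2 (le_max_left _ _)) _)
  · exact hz₂.trans (add_le_add_right (EReal.coe_le_coe_iff.2 (le_max_right _ _)) _)

theorem IsZhouWeightFor.nuNumber_mul {W : Cn n → ℝ≥0∞} {Φ : Cn n → EReal}
    (hZ : IsZhouWeightFor W Φ) (hWint : IntNear W) {R : ℝ} (hR : 0 < R)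
    (hW : AEMeasurable W (volume.restrict (Metric.ball 0 R))) {f g : Cn n → ℂ} (hf : HoloNear f)
    (hg : HoloNear g) (hf0 : ¬ ∀ᶠ z in 𝓝 (0 : Cn n), f z = 0)
    (hg0 : ¬ ∀ᶠ z in 𝓝 (0 : Cn n), g z = 0) :
    nuNumber (fun z => f z * g z) Φ = nuNumber f Φ + nuNumber g Φ := by
  have hfb := hZ.bddAbove_zhouSet hWint hR hW hf hf0
  have hgb := hZ.bddAbove_zhouSet hWint hR hW hg hg0
  have hupper : ∀ b ∈ zhouSet (fun z => f z * g z) Φ, b ≤ nuNumber f Φ + nuNumber g Φ := by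
    intro b hb
    by_contra! hlt
    set δ := (b - (nuNumber f Φ + nuNumber g Φ)) / 2 with hδ
    have hδpos : 0 < δ := by linarith
    have hsum : (nuNumber f Φ + δ) + (nuNumber g Φ + δ) = b := by linarith
    refine hZ.add_notMem_zhouSet_mul hR hW hf hg hf0 hg0
      (add_pos_of_nonneg_of_pos (nuNumber_nonneg f Φ) hδpos)
      (add_pos_of_nonneg_of_pos (nuNumber_nonneg g Φ) hδpos)
      (notMem_of_csSup_lt (lt_add_of_pos_right _ hδpos) hfb)
      (notMem_of_csSup_lt (lt_add_of_pos_right _ hδpos) hgb) (hsum.symm ▸ hb)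
  refine le_antisymm (csSup_le ⟨0, zero_mem_zhouSet (hf.mul hg) Φ⟩ hupper) ?_
  rw [nuNumber_eq_sSup f, nuNumber_eq_sSup g,
    ← csSup_add ⟨0, zero_mem_zhouSet hf Φ⟩ hfb ⟨0, zero_mem_zhouSet hg Φ⟩ hgb]
  refine csSup_le (Set.Nonempty.add ⟨0, zero_mem_zhouSet hf Φ⟩ ⟨0, zero_mem_zhouSet hg Φ⟩) ?_
  rintro _ ⟨b₁, h₁, b₂, h₂, rfl⟩
  exact le_csSup ⟨_, hupper⟩ (add_mem_zhouSet_mul h₁ h₂)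

theorem IsZhouWeightFor.min_le_nuNumber_add {W : Cn n → ℝ≥0∞} {Φ : Cn n → EReal}
    (hZ : IsZhouWeightFor W Φ) (hWint : IntNear W) {R : ℝ} (hR : 0 < R)
    (hW : AEMeasurable W (volume.restrict (Metric.ball 0 R))) {f g : Cn n → ℂ} (hf : HoloNear f)
    (hg : HoloNear g) (hfg : ¬ ∀ᶠ z in 𝓝 (0 : Cn n), f z + g z = 0) :
    min (nuNumber f Φ) (nuNumber g Φ) ≤ nuNumber (fun z => f z + g z) Φ := by
  refine le_of_forall_lt fun b hb => ?_
  rcases lt_or_ge b 0 with hneg | hpos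
  · exact hneg.trans_le (nuNumber_nonneg _ _)
  obtain ⟨c, hbc, hc⟩ := exists_between hb
  have hc0 := hpos.trans hbc.le
  refine hbc.trans_le (le_csSup (hZ.bddAbove_zhouSet hWint hR hW (hf.add hg) hfg) ?_)
  exact mem_zhouSet_add (mem_zhouSet_of_lt_nuNumber hf hc0 (hc.trans_le (min_le_left _ _)))
    (mem_zhouSet_of_lt_nuNumber hg hc0 (hc.trans_le (min_le_right _ _)))

/-- `ν(·,Φ)` is a valuation on the ring of germs of holomorphic functions. -/
theorem statement4 {n m : ℕ} (f₀ : Fin m → Cn n → ℂ) (φ₀ Φ : Cn n → EReal)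
    (hΦ : IsLocalZhouWeight f₀ φ₀ Φ) :
    (∀ f : Cn n → ℂ, HoloNear f → ¬ (∀ᶠ z in 𝓝 (0 : Cn n), f z = 0) →
      0 ≤ nuNumber f Φ) ∧
    (∀ f g : Cn n → ℂ, HoloNear f → HoloNear g →
      ¬ (∀ᶠ z in 𝓝 (0 : Cn n), f z = 0) → ¬ (∀ᶠ z in 𝓝 (0 : Cn n), g z = 0) →
      nuNumber (fun z => f z * g z) Φ = nuNumber f Φ + nuNumber g Φ) ∧
    (∀ f g : Cn n → ℂ, HoloNear f → HoloNear g →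
      ¬ (∀ᶠ z in 𝓝 (0 : Cn n), f z = 0) → ¬ (∀ᶠ z in 𝓝 (0 : Cn n), g z = 0) →
      ¬ (∀ᶠ z in 𝓝 (0 : Cn n), f z + g z = 0) →
      min (nuNumber f Φ) (nuNumber g Φ) ≤ nuNumber (fun z => f z + g z) Φ) ∧
    (∀ f : Cn n → ℂ, HoloNear f → f 0 ≠ 0 → nuNumber f Φ = 0) := by
  obtain ⟨R, hR, hW⟩ := exists_aemeasurable_dens0 hΦ.holo hΦ.psh₀
  refine ⟨fun f _ _ => nuNumber_nonneg f Φ, fun f g hf hg hf0 hg0 =>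
    hΦ.zhou.nuNumber_mul hΦ.int₀ hR hW hf hg hf0 hg0, fun f g hf hg _ _ hfg =>
    hΦ.zhou.min_le_nuNumber_add hΦ.int₀ hR hW hf hg hfg, fun f hf hf0 => ?_⟩
  rw [nuNumber_eq_sSup, hΦ.zhou.zhouSet_eq_of_ne_zero hΦ.int₀ hf hf0, csSup_singleton]
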